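/- Let N ≥ 1, 1 ≤ n ≤ N and d > 0. Let λ, μ ∈ [0,∞)^N satisfy λ_i = 0 for n ≤ i ≤ N−1 and μ_i = 0 for 0 ≤ i ≤ n−1, and suppose ∑_{i=0}^{N−1} λ_i ≥ ∑_{i=0}^{N−1} μ_i. Set P := ∑_{i=0}^{N−1} λ_i and assume P ≥ 2nd (i.e., P/n ≥ 2d). Then (1/2)·e^{−(P + N·d)} ≤ P_e(λ, μ) ≤ e^{−n(P/n + d)} · ( e·(P/n + d)·log((P/n + d)/d) / (P/n) )^{P / log((P/n + d)/d)}. -/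

import Mathlib

open scoped BigOperators

/-- Poisson probability mass at `k` for mean `a`. -/
noncomputable def poissonPdf (a : ℝ) (k : ℕ) : ℝ :=
  Real.exp (-a) * a ^ k / (Nat.factorial k : ℝ)

/-- Joint pmf of independent Poisson coordinates with mean vector `m`. -/
noncomputable def prodPdf {n : ℕ} (m : Fin n → ℝ) (y : Fin n → ℕ) : ℝ :=
  ∏ i, poissonPdf (m i) (y i)

/-- Average error probability of a decoder `g` for the binary hypothesis test between
independent Poisson observations with mean vectors `lam + d` (hypothesis 1) and
`mu + d` (hypothesis 2); `g y = true` means "decide hypothesis 1". -/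
noncomputable def errProb {n : ℕ} (d : ℝ) (lam mu : Fin n → ℝ)
    (g : (Fin n → ℕ) → Bool) : ℝ :=
  (1/2) * (∑' y : Fin n → ℕ, if g y = false then prodPdf (fun i => lam i + d) y else 0)
  + (1/2) * (∑' y : Fin n → ℕ, if g y = true then prodPdf (fun i => mu i + d) y else 0)

/-- Minimal (maximum-likelihood) average error probability. -/
noncomputable def Pe {n : ℕ} (d : ℝ) (lam mu : Fin n → ℝ) : ℝ :=
  ⨅ g : (Fin n → ℕ) → Bool, errProb d lam mu g

/-- Convolution of a codeword `x` of length `N` with channel coefficients `p` of length `K`,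
giving the mean vector of length `N + K - 1`. -/
noncomputable def cconv {N K : ℕ} (x : Fin N → ℝ) (p : Fin K → ℝ) :
    Fin (N + K - 1) → ℝ :=
  fun i => ∑ j : Fin K,
    p j * (if h : (j : ℕ) ≤ (i : ℕ) ∧ (i : ℕ) - (j : ℕ) < N
      then x ⟨(i : ℕ) - (j : ℕ), h.2⟩ else 0)

/-- Sum of the `k` largest entries of `v`. -/
noncomputable def topSum {m : ℕ} (v : Fin m → ℝ) (k : ℕ) : ℝ :=
  ⨆ s ∈ {s : Finset (Fin m) | s.card = k}, ∑ i ∈ s, v i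

/-- Weak submajorization (from below): every top-`k` sum of `u` is at most that of `v`. -/
def weakSubmaj {m : ℕ} (u v : Fin m → ℝ) : Prop :=
  ∀ k, 1 ≤ k → k ≤ m → topSum u k ≤ topSum v k

lemma hasSum_pi_prod {n : ℕ} (f : Fin n → ℕ → ℝ) (a : Fin n → ℝ)
    (hf0 : ∀ i k, 0 ≤ f i k) (hf : ∀ i, HasSum (f i) (a i)) :
    HasSum (fun y : Fin n → ℕ => ∏ i, f i (y i)) (∏ i, a i) := by
  induction n with
  | zero => simp
  | succ n ih =>
    have h1 := ih (fun i => f i.succ) (fun i => a i.succ) (fun i k => hf0 _ k) (fun i => hf _)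
    have hs := Summable.mul_of_nonneg (f := f 0)
      (g := fun y : Fin n → ℕ => ∏ i, f (Fin.succ i) (y i)) (hf 0).summable h1.summable
      (fun k => hf0 0 k) (fun y => Finset.prod_nonneg fun i _ => hf0 _ _)
    have h2 := (hf 0).mul h1 hs
    rw [← (Fin.consEquiv fun _ : Fin (n + 1) => ℕ).hasSum_iff, Fin.prod_univ_succ]
    have he : (fun y : Fin (n + 1) → ℕ => ∏ i, f i (y i)) ∘ Fin.consEquiv (fun _ => ℕ) =
        fun x : ℕ × (Fin n → ℕ) => f 0 x.1 * ∏ i, f (Fin.succ i) (x.2 i) := by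
      ext x
      simp [Fin.consEquiv, Fin.prod_univ_succ]
    rw [he]
    exact h2

lemma poissonPdf_nonneg {a : ℝ} (ha : 0 ≤ a) (k : ℕ) : 0 ≤ poissonPdf a k := by
  unfold poissonPdf; positivity

lemma prodPdf_nonneg {n : ℕ} {m : Fin n → ℝ} (hm : ∀ i, 0 ≤ m i) (y : Fin n → ℕ) :
    0 ≤ prodPdf m y :=
  Finset.prod_nonneg fun i _ => poissonPdf_nonneg (hm i) _

lemma prodPdf_zero {n : ℕ} (m : Fin n → ℝ) :
    prodPdf m (fun _ => 0) = Real.exp (-∑ i, m i) := by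
  simp [prodPdf, poissonPdf, ← Real.exp_sum]

lemma hasSum_poissonPdf_mul_pow (a z : ℝ) :
    HasSum (fun k => poissonPdf a k * z ^ k) (Real.exp (a * (z - 1))) := by
  have h := (NormedSpace.expSeries_div_hasSum_exp (a * z)).mul_left (Real.exp (-a))
  rw [← Real.exp_eq_exp_ℝ, ← Real.exp_add] at h
  have hf : (fun k => poissonPdf a k * z ^ k) =
      fun k : ℕ => Real.exp (-a) * ((a * z) ^ k / (k.factorial : ℝ)) := by
    ext k
    unfold poissonPdf
    ring
  have he : a * (z - 1) = -a + a * z := by ring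
  rw [hf, he]
  exact h

lemma hasSum_prodPdf_mul_prod_pow {n : ℕ} {m z : Fin n → ℝ} (hm : ∀ i, 0 ≤ m i)
    (hz : ∀ i, 0 ≤ z i) :
    HasSum (fun y => prodPdf m y * ∏ i, z i ^ y i) (Real.exp (∑ i, m i * (z i - 1))) := by
  have h := hasSum_pi_prod (fun i k => poissonPdf (m i) k * z i ^ k) _
    (fun i k => mul_nonneg (poissonPdf_nonneg (hm i) k) (pow_nonneg (hz i) k))
    (fun i => hasSum_poissonPdf_mul_pow (m i) (z i))
  simpa only [prodPdf, Finset.prod_mul_distrib, ← Real.exp_sum] using h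

lemma summable_prodPdf {n : ℕ} {m : Fin n → ℝ} (hm : ∀ i, 0 ≤ m i) :
    Summable (prodPdf m) := by
  simpa using (hasSum_prodPdf_mul_prod_pow hm (z := fun _ => 1) fun _ => zero_le_one).summable

lemma summable_ite_prodPdf {n : ℕ} {m : Fin n → ℝ} (hm : ∀ i, 0 ≤ m i)
    (p : (Fin n → ℕ) → Prop) [DecidablePred p] :
    Summable fun y => if p y then prodPdf m y else 0 := by
  refine (summable_prodPdf hm).of_nonneg_of_le (fun y => ?_) fun y => ?_ <;> split_ifs
  exacts [prodPdf_nonneg hm y, le_rfl, le_rfl, prodPdf_nonneg hm y]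

lemma tsum_ite_prodPdf_nonneg {n : ℕ} {m : Fin n → ℝ} (hm : ∀ i, 0 ≤ m i)
    (p : (Fin n → ℕ) → Prop) [DecidablePred p] :
    0 ≤ ∑' y, if p y then prodPdf m y else 0 := by
  refine tsum_nonneg fun y => ?_
  split_ifs
  exacts [prodPdf_nonneg hm y, le_rfl]

lemma exp_neg_sum_le_tsum_ite_prodPdf {n : ℕ} {m : Fin n → ℝ} (hm : ∀ i, 0 ≤ m i)
    (p : (Fin n → ℕ) → Prop) [DecidablePred p] (h0 : p fun _ => 0) :
    Real.exp (-∑ i, m i) ≤ ∑' y, if p y then prodPdf m y else 0 := by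
  have h := (summable_ite_prodPdf hm p).le_tsum (fun _ => 0) fun y _ => by
    split_ifs
    exacts [prodPdf_nonneg hm y, le_rfl]
  rwa [if_pos h0, prodPdf_zero] at h

lemma errProb_nonneg {n : ℕ} {d : ℝ} {lam mu : Fin n → ℝ} (hl : ∀ i, 0 ≤ lam i + d)
    (hm : ∀ i, 0 ≤ mu i + d) (g : (Fin n → ℕ) → Bool) : 0 ≤ errProb d lam mu g := by
  have h1 := tsum_ite_prodPdf_nonneg hl fun y => g y = false
  have h2 := tsum_ite_prodPdf_nonneg hm fun y => g y = true
  unfold errProb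
  positivity

/-- Chernoff bound for an event on which `1 ≤ z ^ S * C`, `S` being the number of counts in the
coordinates of `s`. -/
lemma tsum_ite_prodPdf_le {n : ℕ} {m : Fin n → ℝ} (hm : ∀ i, 0 ≤ m i) (s : Finset (Fin n))
    {z C : ℝ} (hz : 0 ≤ z) (hC : 0 ≤ C) (p : (Fin n → ℕ) → Prop) [DecidablePred p]
    (hp : ∀ y, p y → 1 ≤ z ^ (∑ i ∈ s, y i) * C) :
    (∑' y, if p y then prodPdf m y else 0) ≤ Real.exp ((∑ i ∈ s, m i) * (z - 1)) * C := by
  have h := (hasSum_prodPdf_mul_prod_pow hm (z := fun i => if i ∈ s then z else 1)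
    fun i => by split_ifs <;> positivity).mul_right C
  have hprod (y : Fin n → ℕ) : ∏ i, (if i ∈ s then z else 1) ^ y i = z ^ (∑ i ∈ s, y i) := by
    simp [ite_pow, Finset.prod_ite_mem, Finset.prod_pow_eq_pow_sum]
  have hsum : ∑ i, m i * ((if i ∈ s then z else 1) - 1) = (∑ i ∈ s, m i) * (z - 1) := by
    rw [Finset.sum_mul, ← Finset.sum_filter_add_sum_filter_not Finset.univ (· ∈ s)]
    rw [Finset.sum_congr rfl fun i hi => by rw [if_pos (Finset.mem_filter.1 hi).2],
      Finset.sum_eq_zero (s := Finset.univ.filter (· ∉ s)) fun i hi => by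
        rw [if_neg (Finset.mem_filter.1 hi).2, sub_self, mul_zero]]
    simp
  simp only [hprod, hsum] at h
  rw [← h.tsum_eq]
  refine (summable_ite_prodPdf hm p).tsum_le_tsum (fun y => ?_) h.summable
  have hy := prodPdf_nonneg hm y
  split_ifs with hpy
  · rw [mul_assoc]
    exact le_mul_of_one_le_right hy (hp y hpy)
  · positivity

/-- Bounds on the ML error probability of a code whose two mean vectors have disjoint
supports: `λ` supported on the first `n` coordinates, `μ` on the rest, with
`P = ∑ λ ≥ ∑ μ` and `P/n ≥ 2d`. -/
theorem stmt14 (N n : ℕ) (hn1 : 1 ≤ n) (hnN : n ≤ N) (d : ℝ) (hd : 0 < d)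
    (lam mu : Fin N → ℝ) (hlam0 : ∀ i, 0 ≤ lam i) (hmu0 : ∀ i, 0 ≤ mu i)
    (hlam : ∀ i : Fin N, n ≤ (i : ℕ) → lam i = 0)
    (hmu : ∀ i : Fin N, (i : ℕ) < n → mu i = 0)
    (hsum : (∑ i, mu i) ≤ ∑ i, lam i)
    (P : ℝ) (hPdef : P = ∑ i, lam i) (hP2 : 2 * (n : ℝ) * d ≤ P) :
    (1/2) * Real.exp (-(P + (N : ℝ) * d)) ≤ Pe d lam mu ∧
    Pe d lam mu ≤ Real.exp (-((n : ℝ) * (P / n + d))) *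
        (Real.exp 1 * (P / n + d) * Real.log ((P / n + d) / d) / (P / n))
          ^ (P / Real.log ((P / n + d) / d)) := by
  have hn0 : (0 : ℝ) < n := by exact_mod_cast hn1
  have hP : 0 < P := lt_of_lt_of_le (by positivity) hP2
  have hl (i) : 0 ≤ lam i + d := add_nonneg (hlam0 i) hd.le
  have hm (i) : 0 ≤ mu i + d := add_nonneg (hmu0 i) hd.le
  constructor
  · refine le_ciInf fun g => ?_
    have h1 := tsum_ite_prodPdf_nonneg hl fun y => g y = false
    have h2 := tsum_ite_prodPdf_nonneg hm fun y => g y = true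
    unfold errProb
    cases hg : g fun _ => 0
    · have h := exp_neg_sum_le_tsum_ite_prodPdf hl (fun y => g y = false) hg
      have he : ∑ i, (lam i + d) = P + N * d := by simp [Finset.sum_add_distrib, hPdef]
      rw [he] at h
      linarith
    · have h := exp_neg_sum_le_tsum_ite_prodPdf hm (fun y => g y = true) hg
      have he : ∑ i, (mu i + d) ≤ P + N * d := by simpa [Finset.sum_add_distrib, hPdef] using hsum
      have := Real.exp_le_exp.2 (neg_le_neg he)
      linarith
  set s : Finset (Fin N) := Finset.univ.filter fun i => (i : ℕ) < n with hs
  have hcard : (s.card : ℝ) = n := by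
    rw [hs, Fin.card_filter_val_lt, min_eq_right hnN]
  have hsl : ∑ i ∈ s, (lam i + d) = P + n * d := by
    rw [Finset.sum_add_distrib, Finset.sum_const, nsmul_eq_mul, hcard, hPdef,
      Finset.sum_subset (Finset.subset_univ s)]
    intro i _ hi
    exact hlam i (by simpa [hs] using hi)
  have hsm : ∑ i ∈ s, (mu i + d) = n * d := by
    rw [Finset.sum_add_distrib, Finset.sum_const, nsmul_eq_mul, hcard, Finset.sum_eq_zero, zero_add]
    intro i hi
    exact hmu i (by simpa [hs] using hi)
  set A := P / n + d with hA
  have hAd : d < A := by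
    have : 0 < P / n := by positivity
    linarith
  have hA0 : 0 < A := hd.trans hAd
  have hnA : n * A = P + n * d := by rw [hA]; field_simp
  set L := Real.log (A / d) with hL
  have hL0 : 0 < L := Real.log_pos ((one_lt_div hd).2 hAd)
  set τ := P / L with hτ
  have hτ0 : 0 < τ := by positivity
  have hτ1 : n * d ≤ τ := by
    rw [hτ, le_div_iff₀ hL0]
    calc n * d * L ≤ n * d * (A / d - 1) := by
          gcongr
          exact Real.log_le_sub_one_of_pos (by positivity)
      _ = n * A - n * d := by field_simp
      _ = P := by linarith
  have hτ2 : τ ≤ n * A := by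
    rw [hτ, div_le_iff₀ hL0]
    calc P = n * A - n * d := by linarith
      _ = n * A * (1 - (A / d)⁻¹) := by field_simp
      _ ≤ n * A * L := by
          gcongr
          exact Real.one_sub_inv_le_log_of_pos (by positivity)
  set z := τ / (n * A) with hz
  set w := τ / (n * d) with hw
  have hz0 : 0 < z := by positivity
  have hw0 : 0 < w := by positivity
  have hz1 : z ≤ 1 := (div_le_one (by positivity)).2 hτ2
  have hw1 : 1 ≤ w := (one_le_div (by positivity)).2 hτ1
  have hlogw : Real.log w = Real.log z + L := by
    rw [hL, ← Real.log_mul (by positivity) (by positivity)]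
    congr 1
    rw [hw, hz]
    field_simp
  have hbase : Real.exp 1 * A * L / (P / n) = Real.exp 1 * z⁻¹ := by
    rw [hz, hτ]
    field_simp
  rw [hbase]
  have hB1 : Real.exp ((∑ i ∈ s, (lam i + d)) * (z - 1)) * z ^ (-τ)
      = Real.exp (-(n * A)) * (Real.exp 1 * z⁻¹) ^ τ := by
    rw [Real.mul_rpow (by positivity) (by positivity), Real.exp_one_rpow, ← mul_assoc,
      ← Real.exp_add, Real.inv_rpow hz0.le, Real.rpow_neg hz0.le, hsl, ← hnA]
    congr 2
    rw [hz]
    field_simp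
    ring
  have hB2 : Real.exp ((∑ i ∈ s, (mu i + d)) * (w - 1)) * w ^ (-τ)
      = Real.exp (-(n * A)) * (Real.exp 1 * z⁻¹) ^ τ := by
    rw [← hB1, hsl, hsm, Real.rpow_def_of_pos hz0, Real.rpow_def_of_pos hw0, hlogw,
      ← Real.exp_add, ← Real.exp_add, ← hnA]
    congr 1
    have e1 : n * A * z = τ := by rw [hz]; field_simp
    have e2 : n * d * w = τ := by rw [hw]; field_simp
    have e3 : L * τ = P := by rw [hτ]; field_simp
    linear_combination e2 - e1 - e3 + hnA
  have hbdd : BddBelow (Set.range (errProb d lam mu)) :=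
    ⟨0, by rintro _ ⟨g, rfl⟩; exact errProb_nonneg hl hm g⟩
  refine (ciInf_le hbdd fun y => decide (τ ≤ ((∑ i ∈ s, y i : ℕ) : ℝ))).trans ?_
  have h1 := tsum_ite_prodPdf_le hl s hz0.le (C := z ^ (-τ)) (by positivity)
    (fun y => decide (τ ≤ ((∑ i ∈ s, y i : ℕ) : ℝ)) = false) fun y hy => by
      rw [← Real.rpow_natCast, ← Real.rpow_add hz0]
      refine Real.one_le_rpow_of_pos_of_le_one_of_nonpos hz0 hz1 ?_
      have := not_le.1 (of_decide_eq_false hy)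
      linarith
  have h2 := tsum_ite_prodPdf_le hm s hw0.le (C := w ^ (-τ)) (by positivity)
    (fun y => decide (τ ≤ ((∑ i ∈ s, y i : ℕ) : ℝ)) = true) fun y hy => by
      rw [← Real.rpow_natCast, ← Real.rpow_add hw0]
      refine Real.one_le_rpow hw1 ?_
      have := of_decide_eq_true hy
      linarith
  rw [hB1] at h1
  rw [hB2] at h2
  unfold errProb
  linarith
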